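/- arXiv:2411.19521 — 2 statements merged into one kernel-verified Lean document; each statement's English description precedes it below -/
import Mathlib

section
/- Let M be a matroid of rank r ≥ 1 with finite ground set E of cardinality n = 2r + 1, and assume stress(S) ≤ 0 for every proper subset S ⊊ E. Let T₁, …, T_p be the distinct minimal nonempty crowded subsets of E, and assume T_i ∪ T_j = E for all i ≠ j. Then: (a) the complements E ∖ T₁, …, E ∖ T_p are pairwise disjoint and their union is E, so they partition E; (b) p is odd; and (c) every nonempty subset of E that is a crowding record of crowding 0 is equal to one of the T_i. -/
/-- The crowding of a set `S` in a matroid with rank function `rank`: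
`stress S = |S| - 2 * rank S`. -/
def stress {α : Type*} (rank : Finset α → ℕ) (S : Finset α) : ℤ :=
  (S.card : ℤ) - 2 * (rank S : ℤ)

/-- `T` is a summand of `S` if `rank T + rank (S \ T) = rank S`. -/
def IsSummand {α : Type*} [DecidableEq α] (rank : Finset α → ℕ) (T S : Finset α) : Prop :=
  rank T + rank (S \ T) = rank S

/-- `T` is overcrowded in `S` if either `stress T > stress S`, or `stress T = stress S`
and `T` is not a summand of `S`. -/
def Overcrowded {α : Type*} [DecidableEq α] (rank : Finset α → ℕ) (T S : Finset α) : Prop :=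
  stress rank S < stress rank T ∨
    (stress rank T = stress rank S ∧ ¬ IsSummand rank T S)

/-- `S` is a crowding record if no subset of `S` is overcrowded in `S`. -/
def CrowdingRecord {α : Type*} [DecidableEq α] (rank : Finset α → ℕ) (S : Finset α) : Prop :=
  ∀ T ⊆ S, ¬ Overcrowded rank T S

/-- `T` is a minimal nonempty crowded subset: `T` is nonempty and crowded
(`stress T ≥ 0`), and no nonempty proper subset of `T` is crowded. -/
def MinNonemptyCrowded {α : Type*} (rank : Finset α → ℕ) (T : Finset α) : Prop :=
  T ≠ ∅ ∧ 0 ≤ stress rank T ∧ ∀ T' : Finset α, T' ⊂ T → T' ≠ ∅ → stress rank T' < 0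

theorem exists_minNonemptyCrowded_subset {α : Type*} (rank : Finset α → ℕ) {S : Finset α}
    (hS : S ≠ ∅) (hS' : 0 ≤ stress rank S) : ∃ T ⊆ S, MinNonemptyCrowded rank T := by
  induction S using Finset.strongInduction with
  | H S ih =>
    by_cases h : ∀ T' : Finset α, T' ⊂ S → T' ≠ ∅ → stress rank T' < 0
    · exact ⟨S, subset_rfl, hS, hS', h⟩
    · push Not at h
      obtain ⟨T', hT'S, hT', hstress⟩ := h
      obtain ⟨T, hTT', hT⟩ := ih T' hT'S hT'.ne_empty hstress
      exact ⟨T, hTT'.trans hT'S.subset, hT⟩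

theorem stress_sdiff_of_isSummand {α : Type*} [DecidableEq α] {rank : Finset α → ℕ}
    {T S : Finset α} (hTS : T ⊆ S) (h : IsSummand rank T S) :
    stress rank (S \ T) = stress rank S - stress rank T := by
  have hcard := Finset.card_sdiff_add_card_eq_card hTS
  unfold IsSummand at h
  unfold stress
  lia

/-- Let `M` be a matroid of rank `r ≥ 1` on a ground set of cardinality
`n = 2r + 1` with `stress S ≤ 0` for every proper `S ⊊ E`.  Let `𝒯` be the collection of
minimal nonempty crowded subsets, and assume `T₁ ∪ T₂ = E` for all distinct `T₁, T₂ ∈ 𝒯`.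
Then (a) the complements of the members of `𝒯` are pairwise disjoint and their union is `E`;
(b) `|𝒯|` is odd; (c) every nonempty crowding record of crowding `0` is a member of `𝒯`. -/
theorem case_two_structure {α : Type*} [Fintype α] [DecidableEq α]
    (rank : Finset α → ℕ)
    (hrank_empty : rank ∅ = 0)
    (hrank_mono : ∀ ⦃S T : Finset α⦄, S ⊆ T → rank S ≤ rank T)
    (hrank_submod : ∀ S T : Finset α, rank (S ∪ T) + rank (S ∩ T) ≤ rank S + rank T)
    (hrank_step : ∀ (S : Finset α) (e : α), rank (insert e S) ≤ rank S + 1)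
    (r : ℕ) (hr : 1 ≤ r)
    (hrank_univ : rank Finset.univ = r)
    (hcard : Fintype.card α = 2 * r + 1)
    (hproper : ∀ S : Finset α, S ⊂ Finset.univ → stress rank S ≤ 0)
    (𝒯 : Finset (Finset α))
    (h𝒯 : ∀ T : Finset α, T ∈ 𝒯 ↔ MinNonemptyCrowded rank T)
    (hunion : ∀ T₁ ∈ 𝒯, ∀ T₂ ∈ 𝒯, T₁ ≠ T₂ → T₁ ∪ T₂ = Finset.univ) :
    ((∀ T₁ ∈ 𝒯, ∀ T₂ ∈ 𝒯, T₁ ≠ T₂ →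
        (Finset.univ \ T₁) ∩ (Finset.univ \ T₂) = ∅) ∧
      𝒯.biUnion (fun T => Finset.univ \ T) = Finset.univ) ∧
    Odd 𝒯.card ∧
    (∀ H : Finset α, H ≠ ∅ → CrowdingRecord rank H → stress rank H = 0 → H ∈ 𝒯) := by
  have herase (e : α) :
      Finset.univ.erase e ≠ ∅ ∧ 0 ≤ stress rank (Finset.univ.erase e) := by
    have hc : (Finset.univ.erase e).card = 2 * r := by
      rw [Finset.card_erase_of_mem (Finset.mem_univ e), Finset.card_univ, hcard]
      lia
    have hle := hrank_mono (Finset.subset_univ (Finset.univ.erase e))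
    refine ⟨fun h => ?_, ?_⟩
    · rw [h, Finset.card_empty] at hc
      lia
    · unfold stress
      lia
  have hcover (e : α) : ∃ T ∈ 𝒯, e ∉ T := by
    obtain ⟨T, hT, hmin⟩ := exists_minNonemptyCrowded_subset rank (herase e).1 (herase e).2
    exact ⟨T, (h𝒯 T).2 hmin, fun he => Finset.notMem_erase e _ (hT he)⟩
  have hstress_univ : stress rank Finset.univ = 1 := by
    unfold stress
    rw [Finset.card_univ]
    lia
  have hzero (T : Finset α) (hT : T ∈ 𝒯) : stress rank T = 0 := by
    obtain ⟨-, hnonneg, hmin⟩ := (h𝒯 T).1 hT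
    refine le_antisymm (hproper T (Finset.ssubset_univ_iff.2 ?_)) hnonneg
    rintro rfl
    have : 0 < Fintype.card α := by lia
    obtain ⟨e⟩ := Fintype.card_pos_iff.1 this
    exact (herase e).2.not_gt
      (hmin _ (Finset.erase_ssubset (Finset.mem_univ e)) (herase e).1)
  have hdisj : ∀ T₁ ∈ 𝒯, ∀ T₂ ∈ 𝒯, T₁ ≠ T₂ →
      (Finset.univ \ T₁) ∩ (Finset.univ \ T₂) = ∅ := by
    intro T₁ h₁ T₂ h₂ hne
    rw [← Finset.sdiff_union_distrib, hunion T₁ h₁ T₂ h₂ hne, sdiff_self, Finset.bot_eq_empty]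
  have hbiUnion : 𝒯.biUnion (fun T => Finset.univ \ T) = Finset.univ := by
    simpa [Finset.eq_univ_iff_forall] using hcover
  refine ⟨⟨hdisj, hbiUnion⟩, ?_, ?_⟩
  · have hsum : ∑ T ∈ 𝒯, (Finset.univ \ T).card = 2 * r + 1 := by
      rw [← Finset.card_biUnion fun T₁ h₁ T₂ h₂ hne =>
        Finset.disjoint_iff_inter_eq_empty.2 (hdisj T₁ h₁ T₂ h₂ hne), hbiUnion,
        Finset.card_univ, hcard]
    have hodd (T : Finset α) (hT : T ∈ 𝒯) : Odd (Finset.univ \ T).card := by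
      have hT0 := hzero T hT
      have hc := Finset.card_sdiff_add_card_eq_card (Finset.subset_univ T)
      rw [Finset.card_univ, hcard] at hc
      unfold stress at hT0
      rw [Nat.odd_iff]
      lia
    have hiff := Finset.odd_sum_iff_odd_card_odd (s := 𝒯) fun T => (Finset.univ \ T).card
    rw [Finset.filter_true_of_mem hodd] at hiff
    exact hiff.1 ⟨r, hsum⟩
  · intro H hH hrecord hH0
    obtain ⟨T, hTH, hmin⟩ := exists_minNonemptyCrowded_subset rank hH hH0.ge
    have hT := (h𝒯 T).2 hmin
    by_cases hEq : T = H
    · exact hEq ▸ hT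
    exfalso
    have hsummand : IsSummand rank T H := by
      by_contra hns
      exact hrecord T hTH (Or.inr ⟨by rw [hzero T hT, hH0], hns⟩)
    have hsdiff : H \ T ≠ ∅ := fun h =>
      hEq (hTH.antisymm (Finset.sdiff_eq_empty_iff_subset.1 h))
    obtain ⟨T', hT'H, hmin'⟩ := exists_minNonemptyCrowded_subset rank hsdiff
      (by rw [stress_sdiff_of_isSummand hTH hsummand, hH0, hzero T hT, sub_zero])
    have hne : T ≠ T' := by
      rintro rfl
      exact hmin'.1 (disjoint_self.1 (Finset.disjoint_sdiff.mono_right hT'H))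
    have hsub := Finset.union_subset hTH (hT'H.trans Finset.sdiff_subset)
    rw [hunion T hT T' ((h𝒯 T').2 hmin') hne, Finset.univ_subset_iff] at hsub
    rw [hsub, hstress_univ] at hH0
    exact one_ne_zero hH0
end

section
/- Let M be a matroid of rank r with finite ground set E. Then for every x ∈ ℝ^E, 1_{Δ(M)}(x) = Σ_{S•} (−1)^{k−1} · 1_{⊓^{S•,M}}(x), where the sum is over all chains S• : ∅ = S₀ ⊊ S₁ ⊊ ⋯ ⊊ S_k = E of subsets of E (of any length k). -/
/-- The base polytope of a matroid of rank `r` with rank function `rank`: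
`{x : Σ_{e ∈ S} x_e ≤ rank S for all S, and Σ_e x_e = r}`. -/
def basePolytope {α : Type*} [Fintype α] (rank : Finset α → ℕ) (r : ℕ) : Set (α → ℝ) :=
  {x | (∀ S : Finset α, ∑ e ∈ S, x e ≤ (rank S : ℝ)) ∧ ∑ e, x e = (r : ℝ)}

/-- The hypersimplex `Δ(r, E)`. -/
def hypersimplex (α : Type*) [Fintype α] (r : ℕ) : Set (α → ℝ) :=
  {x | (∀ e, 0 ≤ x e ∧ x e ≤ 1) ∧ ∑ e, x e = (r : ℝ)}

/-- The half-open Schubert polytope `⊓^{S•,M}` associated to a chain whose set of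
intermediate members is `C`: the points of the hypersimplex satisfying
`Σ_{e ∈ A} x_e > rank A` for each member `A` of the chain. -/
def halfOpenSchubert {α : Type*} [Fintype α] (rank : Finset α → ℕ) (r : ℕ)
    (C : Finset (Finset α)) : Set (α → ℝ) :=
  {x | x ∈ hypersimplex α r ∧ ∀ A ∈ C, (rank A : ℝ) < ∑ e ∈ A, x e}

open Classical in
/-- The element toggled in a chain `C` by the involution that contracts the order complex onto
the cone point `a`. -/
noncomputable def chainPivot {β : Type*} [SemilatticeSup β] [OrderBot β] (a : β)
    (C : Finset β) : β :=
  a ⊔ (C.filter (fun b => ¬ a ≤ b)).sup id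

lemma le_chainPivot {β : Type*} [SemilatticeSup β] [OrderBot β] (a : β) (C : Finset β) :
    a ≤ chainPivot a C := le_sup_left

open Classical in
lemma chainPivot_insert {β : Type*} [SemilatticeSup β] [OrderBot β] (a : β) (C : Finset β)
    {t : β} (ht : a ≤ t) : chainPivot a (insert t C) = chainPivot a C := by
  simp [chainPivot, Finset.filter_insert, ht]

open Classical in
lemma chainPivot_erase {β : Type*} [SemilatticeSup β] [OrderBot β] (a : β) (C : Finset β)
    {t : β} (ht : a ≤ t) : chainPivot a (C.erase t) = chainPivot a C := by
  rw [← chainPivot_insert a (C.erase t) ht]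
  by_cases h : t ∈ C
  · rw [Finset.insert_erase h]
  · rw [Finset.erase_eq_of_notMem h, chainPivot_insert a C ht]

open Classical in
lemma chainPivot_mem {β : Type*} [SemilatticeSup β] [OrderBot β] {P : Finset β} {a : β}
    (ha : a ∈ P) (hP : ∀ b ∈ P, a ⊔ b ∈ P) {C : Finset β} (hCP : C ⊆ P)
    (hC : IsChain (· ≤ ·) (C : Set β)) : chainPivot a C ∈ P := by
  unfold chainPivot
  rcases (C.filter (fun b => ¬ a ≤ b)).eq_empty_or_nonempty with h | h
  · simpa [h] using ha
  · obtain ⟨m, hm⟩ := Finset.exists_maximal h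
    have hmC := (Finset.mem_filter.1 hm.1).1
    have hsup : (C.filter (fun b => ¬ a ≤ b)).sup id = m := by
      refine le_antisymm (Finset.sup_le fun b hb => ?_) (Finset.le_sup (f := id) hm.1)
      rcases hC.total (Finset.mem_filter.1 hb).1 hmC with h1 | h1
      · exact h1
      · exact hm.2 hb h1
    rw [hsup]
    exact hP m (hCP hmC)

lemma chainPivot_comparable {β : Type*} [SemilatticeSup β] [OrderBot β] {a : β} {C : Finset β}
    (hC : IsChain (· ≤ ·) (C : Set β)) {b : β} (hb : b ∈ C) :
    chainPivot a C ≤ b ∨ b ≤ chainPivot a C := by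
  classical
  by_cases hab : a ≤ b
  · left
    refine sup_le hab (Finset.sup_le fun c hc => ?_)
    obtain ⟨hcC, hac⟩ := Finset.mem_filter.1 hc
    rcases hC.total hcC hb with h | h
    · exact h
    · exact absurd (hab.trans h) hac
  · right
    exact le_sup_of_le_right (Finset.le_sup (f := id) (Finset.mem_filter.2 ⟨hb, hab⟩))

open Classical in
/-- A finite poset that is a cone via `b ≤ a ⊔ b ≥ a` has vanishing reduced Euler
characteristic. -/
lemma sum_chains_neg_one_pow_eq_zero {β : Type*} [SemilatticeSup β] [OrderBot β]
    {P : Finset β} {a : β} (ha : a ∈ P) (hP : ∀ b ∈ P, a ⊔ b ∈ P) :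
    ∑ C ∈ P.powerset.filter (fun C : Finset β => IsChain (· ≤ ·) (C : Set β)),
      (-1 : ℤ) ^ C.card = 0 := by
  refine Finset.sum_involution
    (fun C _ => if chainPivot a C ∈ C then C.erase (chainPivot a C)
      else insert (chainPivot a C) C) ?_ ?_ ?_ ?_
  · intro C _
    split_ifs with h
    · rw [← Finset.card_erase_add_one h, pow_succ]
      ring
    · rw [Finset.card_insert_of_notMem h, pow_succ]
      ring
  · intro C _ _
    split_ifs with h
    · exact fun h' => Finset.notMem_erase (chainPivot a C) C (h'.symm ▸ h)
    · exact fun h' => h (Finset.insert_eq_self.1 h')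
  · intro C hC
    obtain ⟨hCP, hCc⟩ := Finset.mem_filter.1 hC
    rw [Finset.mem_powerset] at hCP
    rw [Finset.mem_filter, Finset.mem_powerset]
    split_ifs with h
    · exact ⟨(Finset.erase_subset _ _).trans hCP,
        hCc.mono (Finset.coe_subset.2 (Finset.erase_subset _ _))⟩
    · refine ⟨Finset.insert_subset (chainPivot_mem ha hP hCP hCc) hCP, ?_⟩
      rw [Finset.coe_insert]
      exact hCc.insert fun b hb _ => chainPivot_comparable hCc hb
  · intro C _
    by_cases h : chainPivot a C ∈ C
    · simp [h, chainPivot_erase a C (le_chainPivot a C), Finset.insert_erase h]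
    · simp [h, chainPivot_insert a C (le_chainPivot a C), Finset.erase_insert h]

lemma basePolytope_subset_hypersimplex {α : Type*} [Fintype α] [DecidableEq α]
    {rank : Finset α → ℕ} (hrank_empty : rank ∅ = 0)
    (hrank_mono : ∀ ⦃S T : Finset α⦄, S ⊆ T → rank S ≤ rank T)
    (hrank_step : ∀ (S : Finset α) (e : α), rank (insert e S) ≤ rank S + 1)
    {r : ℕ} (hrank_univ : rank Finset.univ = r) :
    basePolytope rank r ⊆ hypersimplex α r := by
  rintro x ⟨hx, hsum⟩
  refine ⟨fun e => ⟨?_, ?_⟩, hsum⟩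
  · have h1 := hx (Finset.univ.erase e)
    have h2 : (rank (Finset.univ.erase e) : ℝ) ≤ r := by
      exact_mod_cast (hrank_mono (Finset.subset_univ _)).trans_eq hrank_univ
    have h3 := Finset.sum_erase_add Finset.univ x (Finset.mem_univ e)
    linarith
  · have h1 := hx {e}
    have h2 : (rank {e} : ℝ) ≤ 1 := by
      have := hrank_step ∅ e
      rw [hrank_empty] at this
      exact_mod_cast this
    rw [Finset.sum_singleton] at h1
    linarith

/-- If some set is violated, a set of maximal violation is a cone point for the family of
violated sets. -/
lemma exists_violated_union_closed {α : Type*} [Fintype α] [DecidableEq α]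
    {rank : Finset α → ℕ}
    (hrank_submod : ∀ S T : Finset α, rank (S ∪ T) + rank (S ∩ T) ≤ rank S + rank T)
    {x : α → ℝ} (hx : ∃ S : Finset α, (rank S : ℝ) < ∑ e ∈ S, x e) :
    ∃ A : Finset α, (rank A : ℝ) < ∑ e ∈ A, x e ∧
      ∀ B : Finset α, (rank B : ℝ) < ∑ e ∈ B, x e →
        (rank (A ∪ B) : ℝ) < ∑ e ∈ A ∪ B, x e := by
  obtain ⟨S, hS⟩ := hx
  obtain ⟨A, -, hA⟩ := Finset.exists_max_image (Finset.univ : Finset (Finset α))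
    (fun S => ∑ e ∈ S, x e - (rank S : ℝ)) ⟨S, Finset.mem_univ S⟩
  refine ⟨A, ?_, fun B hB => ?_⟩
  · have := hA S (Finset.mem_univ S)
    linarith
  · have h1 := hA (A ∩ B) (Finset.mem_univ _)
    have h2 := Finset.sum_union_inter (s₁ := A) (s₂ := B) (f := x)
    have h3 : (rank (A ∪ B) : ℝ) + rank (A ∩ B) ≤ rank A + rank B := by
      exact_mod_cast hrank_submod A B
    linarith

/-- Let `M` be a matroid of rank `r` on a finite ground set `E`.
Then, pointwise, `1_{Δ(M)} = Σ_{S•} (-1)^{k-1} 1_{⊓^{S•,M}}`, the sum being over all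
chains `∅ = S₀ ⊊ S₁ ⊊ ⋯ ⊊ S_k = E`.  A chain is recorded by the finite set `C` of its
intermediate members `S₁, …, S_{k-1}` (a totally ordered family of proper nonempty
subsets), so that `k = |C| + 1` and `(-1)^{k-1} = (-1)^{|C|}`. -/
theorem indicator_basePolytope_eq_sum_halfOpen {α : Type*} [Fintype α] [DecidableEq α]
    (rank : Finset α → ℕ)
    (hrank_empty : rank ∅ = 0)
    (hrank_mono : ∀ ⦃S T : Finset α⦄, S ⊆ T → rank S ≤ rank T)
    (hrank_submod : ∀ S T : Finset α, rank (S ∪ T) + rank (S ∩ T) ≤ rank S + rank T)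
    (hrank_step : ∀ (S : Finset α) (e : α), rank (insert e S) ≤ rank S + 1)
    (r : ℕ) (hrank_univ : rank Finset.univ = r)
    (x : α → ℝ) :
    Set.indicator (basePolytope rank r) (fun _ => (1 : ℤ)) x =
      ∑ C ∈ Finset.univ.filter (fun C : Finset (Finset α) =>
          (∀ A ∈ C, A ≠ ∅ ∧ A ≠ Finset.univ) ∧
          (∀ A ∈ C, ∀ B ∈ C, A ⊆ B ∨ B ⊆ A)),
        (-1 : ℤ) ^ C.card *
          Set.indicator (halfOpenSchubert rank r C) (fun _ => (1 : ℤ)) x := by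
  classical
  by_cases hH : x ∈ hypersimplex α r
  swap
  · have hB : x ∉ basePolytope rank r := fun h =>
      hH (basePolytope_subset_hypersimplex hrank_empty hrank_mono hrank_step hrank_univ h)
    rw [Set.indicator_of_notMem hB]
    refine (Finset.sum_eq_zero fun C _ => ?_).symm
    rw [Set.indicator_of_notMem (fun h => hH h.1), mul_zero]
  set P : Finset (Finset α) :=
    Finset.univ.filter (fun A => (rank A : ℝ) < ∑ e ∈ A, x e) with hPdef
  have hmemP : ∀ A, A ∈ P ↔ (rank A : ℝ) < ∑ e ∈ A, x e := fun A => by simp [hPdef]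
  have hproper : ∀ A ∈ P, A ≠ ∅ ∧ A ≠ Finset.univ := by
    refine fun A hA => ⟨?_, ?_⟩
    · rintro rfl
      simp [hmemP, hrank_empty] at hA
    · rintro rfl
      rw [hmemP, hrank_univ, hH.2] at hA
      exact lt_irrefl _ hA
  have hsum : ∑ C ∈ Finset.univ.filter (fun C : Finset (Finset α) =>
          (∀ A ∈ C, A ≠ ∅ ∧ A ≠ Finset.univ) ∧
          (∀ A ∈ C, ∀ B ∈ C, A ⊆ B ∨ B ⊆ A)),
        (-1 : ℤ) ^ C.card *
          Set.indicator (halfOpenSchubert rank r C) (fun _ => (1 : ℤ)) x =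
      ∑ C ∈ P.powerset.filter
          (fun C : Finset (Finset α) => IsChain (· ≤ ·) (C : Set (Finset α))),
        (-1 : ℤ) ^ C.card := by
    symm
    refine Finset.sum_subset_zero_on_sdiff (fun C hC => ?_) (fun C hC => ?_) (fun C hC => ?_)
    · obtain ⟨hCP, hCc⟩ := Finset.mem_filter.1 hC
      rw [Finset.mem_powerset] at hCP
      exact Finset.mem_filter.2 ⟨Finset.mem_univ C, fun A hA => hproper A (hCP hA),
        fun A hA B hB => hCc.total hA hB⟩
    · obtain ⟨hC1, hC2⟩ := Finset.mem_sdiff.1 hC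
      rw [Set.indicator_of_notMem, mul_zero]
      refine fun h => hC2 (Finset.mem_filter.2 ⟨Finset.mem_powerset.2 fun A hA =>
        (hmemP A).2 (h.2 A hA), fun A hA B hB _ => ?_⟩)
      exact (Finset.mem_filter.1 hC1).2.2 A hA B hB
    · have hCP := Finset.mem_powerset.1 (Finset.mem_filter.1 hC).1
      have hmem : x ∈ halfOpenSchubert rank r C := ⟨hH, fun A hA => (hmemP A).1 (hCP hA)⟩
      rw [Set.indicator_of_mem hmem, mul_one]
  rw [hsum]
  by_cases hv : ∃ S : Finset α, (rank S : ℝ) < ∑ e ∈ S, x e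
  · obtain ⟨A, hA, hAB⟩ := exists_violated_union_closed hrank_submod hv
    obtain ⟨S, hS⟩ := hv
    rw [Set.indicator_of_notMem (fun h => (h.1 S).not_gt hS)]
    exact (sum_chains_neg_one_pow_eq_zero ((hmemP A).2 hA)
      fun B hB => (hmemP _).2 (hAB B ((hmemP B).1 hB))).symm
  · push Not at hv
    have hP : P = ∅ := Finset.filter_eq_empty_iff.2 fun A _ => (hv A).not_gt
    have hmem : x ∈ basePolytope rank r := ⟨hv, hH.2⟩
    rw [Set.indicator_of_mem hmem, hP]
    simp [Finset.filter_singleton]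
end
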